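/- arXiv:2602.16293 — 6 statements merged into one kernel-verified Lean document; each statement's English description precedes it below -/
import Mathlib

section
/- Let n ≥ 1, 0 ≤ q < n/2, and s > q − n/2. There exists a constant C > 0 such that for every t ≥ 0 and every measurable function f : ℝⁿ → ℂ one has ( ∫_{ℝⁿ} |ξ|^{2s} |K̂(t,ξ)|² |f(ξ)|² dξ )^{1/2} ≤ C (1+t)^{−n/4 − (s−q)/2} [ ( ∫_{ℝⁿ} ⟨ξ⟩^{2(s−1)} |f(ξ)|² dξ )^{1/2} + sup_{ξ ∈ ℝⁿ} |ξ|^q |f(ξ)| ]. -/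
open MeasureTheory Real FourierTransform Filter
open scoped ENNReal

noncomputable section

abbrev Rn (n : ℕ) : Type := EuclideanSpace ℝ (Fin n)

/-- Fourier image of the damped wave kernel. -/
def Khat {n : ℕ} (t : ℝ) (ξ : Rn n) : ℝ :=
  if ‖ξ‖ < 1/2 then
    Real.exp (-t/2) * Real.sinh (t * Real.sqrt (1/4 - ‖ξ‖^2)) / Real.sqrt (1/4 - ‖ξ‖^2)
  else if ‖ξ‖ = 1/2 then t * Real.exp (-t/2)
  else Real.exp (-t/2) * Real.sin (t * Real.sqrt (‖ξ‖^2 - 1/4)) / Real.sqrt (‖ξ‖^2 - 1/4)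

/-- Time derivative of the kernel. -/
def KhatDt {n : ℕ} (t : ℝ) (ξ : Rn n) : ℝ := deriv (fun s => Khat s ξ) t

/-- Riesz potential `I_γ`. -/
def riesz (n : ℕ) (γ : ℝ) (f : Rn n → ℝ) : Rn n → ℝ :=
  if γ = 0 then f
  else fun x =>
    (Real.Gamma (((n : ℝ) - γ)/2) / (2 ^ γ * Real.pi ^ ((n : ℝ)/2) * Real.Gamma (γ/2))) *
      ∫ y : Rn n, f y * ‖x - y‖ ^ (-((n : ℝ) - γ))

/-- `g` represents the Fourier transform of `f` in the tempered-distribution sense. -/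
def HasFourier {n : ℕ} (f g : Rn n → ℂ) : Prop :=
  ∀ ψ : SchwartzMap (Rn n) ℂ,
    ∫ x : Rn n, f x * 𝓕 (fun y => ψ y) x = ∫ ξ : Rn n, g ξ * ψ ξ

/-- The Laplacian (sum of repeated coordinate second derivatives). -/
def lap {n : ℕ} (f : Rn n → ℝ) (x : Rn n) : ℝ :=
  ∑ i : Fin n,
    fderiv ℝ (fun y => fderiv ℝ f y (EuclideanSpace.single i 1)) x (EuclideanSpace.single i 1)

/-- The hyperbolic sine is bounded by `x * exp x`. -/
theorem sinh_le_mul_exp (x : ℝ) : Real.sinh x ≤ x * Real.exp x := by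
  have h1 : 1 - Real.exp (-2 * x) ≤ 2 * x := by
    linarith [Real.add_one_le_exp (-2 * x)]
  have h2 : Real.exp (-x) = Real.exp x * Real.exp (-2 * x) := by
    rw [← Real.exp_add]; congr 1; ring
  rw [Real.sinh_eq, h2]
  nlinarith [Real.exp_pos x]

theorem sinh_le_exp (x : ℝ) : Real.sinh x ≤ Real.exp x := by
  rw [Real.sinh_eq]
  linarith [Real.exp_pos x, Real.exp_pos (-x)]

theorem sqrt_quarter_sub_sq_le {r : ℝ} (hr : r ^ 2 ≤ 1 / 4) :
    Real.sqrt (1 / 4 - r ^ 2) ≤ 1 / 2 - r ^ 2 := by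
  apply Real.sqrt_le_iff.mpr
  constructor <;> nlinarith [sq_nonneg (r ^ 2)]

theorem exp_mul_exp_sqrt_le {t r : ℝ} (ht : 0 ≤ t) (hr : r ^ 2 ≤ 1 / 4) :
    Real.exp (-t / 2) * Real.exp (t * Real.sqrt (1 / 4 - r ^ 2)) ≤ Real.exp (-t * r ^ 2) := by
  rw [← Real.exp_add]
  apply Real.exp_le_exp.mpr
  nlinarith [mul_le_mul_of_nonneg_left (sqrt_quarter_sub_sq_le hr) ht]

theorem Khat_nonneg_of_norm_lt_half {n : ℕ} {t : ℝ} (ht : 0 ≤ t) {ξ : Rn n} (h : ‖ξ‖ < 1 / 2) :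
    0 ≤ Khat t ξ := by
  have : 0 ≤ Real.sinh (t * Real.sqrt (1 / 4 - ‖ξ‖ ^ 2)) :=
    Real.sinh_nonneg_iff.mpr (by positivity)
  rw [Khat, if_pos h]
  positivity

theorem abs_Khat_le_of_norm_le_quarter {n : ℕ} {t : ℝ} (ht : 0 ≤ t) {ξ : Rn n}
    (h : ‖ξ‖ ≤ 1 / 4) : |Khat t ξ| ≤ 4 * Real.exp (-t * ‖ξ‖ ^ 2) := by
  have hlt : ‖ξ‖ < 1 / 2 := by linarith
  have hsq : ‖ξ‖ ^ 2 ≤ 1 / 16 := by nlinarith [norm_nonneg ξ]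
  rw [abs_of_nonneg (Khat_nonneg_of_norm_lt_half ht hlt), Khat, if_pos hlt]
  have hl : 1 / 4 ≤ Real.sqrt (1 / 4 - ‖ξ‖ ^ 2) := Real.le_sqrt_of_sq_le (by linarith)
  have he := exp_mul_exp_sqrt_le ht (r := ‖ξ‖) (by linarith)
  rw [div_le_iff₀ (by linarith)]
  have h1 := mul_le_mul_of_nonneg_left (sinh_le_exp (t * Real.sqrt (1 / 4 - ‖ξ‖ ^ 2)))
    (Real.exp_pos (-t / 2)).le
  nlinarith [Real.exp_pos (-t * ‖ξ‖ ^ 2)]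

theorem abs_Khat_le_of_half_lt_norm {n : ℕ} {t : ℝ} (ht : 0 ≤ t) {ξ : Rn n}
    (h : 1 / 2 < ‖ξ‖) : |Khat t ξ| ≤ t * Real.exp (-t / 2) := by
  have hpos : 0 < Real.sqrt (‖ξ‖ ^ 2 - 1 / 4) := Real.sqrt_pos.mpr (by nlinarith)
  rw [Khat, if_neg (by linarith), if_neg (by linarith), abs_div, abs_mul, abs_of_pos hpos,
    abs_of_pos (Real.exp_pos _), div_le_iff₀ hpos]
  have h1 := Real.abs_sin_le_abs (x := t * Real.sqrt (‖ξ‖ ^ 2 - 1 / 4))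
  rw [abs_of_nonneg (by positivity : 0 ≤ t * Real.sqrt (‖ξ‖ ^ 2 - 1 / 4))] at h1
  nlinarith [mul_le_mul_of_nonneg_left h1 (Real.exp_pos (-t / 2)).le]

theorem abs_Khat_le_of_quarter_le_norm {n : ℕ} {t : ℝ} (ht : 0 ≤ t) {ξ : Rn n}
    (h : 1 / 4 ≤ ‖ξ‖) : |Khat t ξ| ≤ t * Real.exp (-t / 16) := by
  have hmono : t * Real.exp (-t / 2) ≤ t * Real.exp (-t / 16) :=
    mul_le_mul_of_nonneg_left (Real.exp_le_exp.mpr (by linarith)) ht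
  rcases lt_trichotomy ‖ξ‖ (1 / 2) with hlt | heq | hgt
  · have hsq : ‖ξ‖ ^ 2 < 1 / 4 := by nlinarith
    have hsq' : 1 / 16 ≤ ‖ξ‖ ^ 2 := by nlinarith
    rw [abs_of_nonneg (Khat_nonneg_of_norm_lt_half ht hlt), Khat, if_pos hlt]
    set l := Real.sqrt (1 / 4 - ‖ξ‖ ^ 2) with hl
    have hpos : 0 < l := Real.sqrt_pos.mpr (by linarith)
    have he := exp_mul_exp_sqrt_le ht (r := ‖ξ‖) hsq.le
    have he' : Real.exp (-t * ‖ξ‖ ^ 2) ≤ Real.exp (-t / 16) :=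
      Real.exp_le_exp.mpr (by nlinarith)
    rw [div_le_iff₀ hpos]
    calc Real.exp (-t / 2) * Real.sinh (t * l)
        ≤ Real.exp (-t / 2) * (t * l * Real.exp (t * l)) := by
          gcongr; exact sinh_le_mul_exp _
      _ = t * l * (Real.exp (-t / 2) * Real.exp (t * l)) := by ring
      _ ≤ t * l * Real.exp (-t / 16) := by gcongr; exact he.trans he'
      _ = t * Real.exp (-t / 16) * l := by ring
  · rw [Khat, if_neg (by linarith), if_pos heq, abs_of_nonneg (by positivity)]
    exact hmono
  · exact (abs_Khat_le_of_half_lt_norm ht hgt).trans hmono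

theorem Khat_sq_mul_le_of_quarter_le_norm {n : ℕ} {t : ℝ} (ht : 0 ≤ t) {ξ : Rn n}
    (h : 1 / 4 ≤ ‖ξ‖) :
    Khat t ξ ^ 2 * (1 + ‖ξ‖ ^ 2) ≤ 4 * ((1 + t) ^ 2 * Real.exp (-(t / 8))) := by
  have hexp : Real.exp (-t / 16) ^ 2 = Real.exp (-(t / 8)) := by
    rw [← Real.exp_nat_mul]; congr 1; push_cast; ring
  have hE := Real.exp_pos (-(t / 8))
  rcases le_or_gt ‖ξ‖ 1 with h1 | h1
  · have hK : Khat t ξ ^ 2 ≤ t ^ 2 * Real.exp (-(t / 8)) := by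
      rw [← hexp, ← mul_pow, ← sq_abs (Khat t ξ)]
      exact pow_le_pow_left₀ (abs_nonneg _) (abs_Khat_le_of_quarter_le_norm ht h) 2
    have h2 : 1 + ‖ξ‖ ^ 2 ≤ 4 := by nlinarith
    calc Khat t ξ ^ 2 * (1 + ‖ξ‖ ^ 2)
        ≤ (t ^ 2 * Real.exp (-(t / 8))) * 4 := by gcongr
      _ ≤ ((1 + t) ^ 2 * Real.exp (-(t / 8))) * 4 := by gcongr; linarith
      _ = _ := by ring
  · have hd : 0 < ‖ξ‖ ^ 2 - 1 / 4 := by nlinarith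
    have hK : Khat t ξ ^ 2 * (‖ξ‖ ^ 2 - 1 / 4) ≤ Real.exp (-(t / 8)) := by
      rw [Khat, if_neg (by linarith), if_neg (by linarith), div_pow, Real.sq_sqrt hd.le,
        div_mul_cancel₀ _ hd.ne', mul_pow]
      calc _ ≤ Real.exp (-t / 2) ^ 2 * 1 := by gcongr; exact Real.sin_sq_le_one _
        _ ≤ Real.exp (-t / 16) ^ 2 := by
          rw [mul_one]; gcongr ?_ ^ 2
          exact Real.exp_le_exp.mpr (by linarith)
        _ = _ := hexp
    have h3 : 1 + ‖ξ‖ ^ 2 ≤ 4 * (‖ξ‖ ^ 2 - 1 / 4) := by nlinarith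
    calc Khat t ξ ^ 2 * (1 + ‖ξ‖ ^ 2)
        ≤ Khat t ξ ^ 2 * (4 * (‖ξ‖ ^ 2 - 1 / 4)) := by gcongr
      _ = 4 * (Khat t ξ ^ 2 * (‖ξ‖ ^ 2 - 1 / 4)) := by ring
      _ ≤ 4 * Real.exp (-(t / 8)) := by linarith
      _ ≤ 4 * ((1 + t) ^ 2 * Real.exp (-(t / 8))) := by
        have h4 : 1 ≤ (1 + t) ^ 2 := by nlinarith
        linarith [le_mul_of_one_le_left hE.le h4]

theorem exists_one_add_sq_mul_exp_le_rpow (a : ℝ) :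
    ∃ C > (0 : ℝ), ∀ t : ℝ, 0 ≤ t → (1 + t) ^ 2 * Real.exp (-(t / 8)) ≤ C * (1 + t) ^ a := by
  obtain ⟨N, hN⟩ := exists_nat_ge (2 - a)
  refine ⟨8 ^ N * N.factorial * Real.exp (1 / 8), by positivity, fun t ht => ?_⟩
  have hy : 0 < 1 + t := by linarith
  have h1 : (1 + t) ^ (2 - a) ≤ (1 + t) ^ N := by
    rw [← Real.rpow_natCast]
    exact Real.rpow_le_rpow_of_exponent_le (by linarith) hN
  have h2 := Real.pow_div_factorial_le_exp ((1 + t) / 8) (by positivity) N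
  rw [div_pow, div_div, div_le_iff₀ (by positivity)] at h2
  have h3 : Real.exp ((1 + t) / 8) * Real.exp (-(t / 8)) = Real.exp (1 / 8) := by
    rw [← Real.exp_add]; congr 1; ring
  calc (1 + t) ^ 2 * Real.exp (-(t / 8))
      = (1 + t) ^ (2 - a) * (1 + t) ^ a * Real.exp (-(t / 8)) := by
        rw [← Real.rpow_add hy, sub_add_cancel, Real.rpow_two]
    _ ≤ (Real.exp ((1 + t) / 8) * (8 ^ N * N.factorial)) * (1 + t) ^ a
          * Real.exp (-(t / 8)) := by
        gcongr; exact h1.trans h2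
    _ = 8 ^ N * N.factorial * (Real.exp ((1 + t) / 8) * Real.exp (-(t / 8))) * (1 + t) ^ a := by
        ring
    _ = _ := by rw [h3]

theorem rpow_two_mul_le_of_quarter_le {r : ℝ} (hr : 1 / 4 ≤ r) (s : ℝ) :
    r ^ (2 * s) ≤ 17 ^ |s| * (1 + r ^ 2) ^ s := by
  have h0 : 0 < r := by linarith
  have h17 : (1 : ℝ) ≤ 17 ^ |s| := Real.one_le_rpow (by norm_num) (abs_nonneg s)
  rw [Real.rpow_mul h0.le, Real.rpow_two]
  rcases le_total 0 s with hs | hs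
  · calc (r ^ 2) ^ s ≤ (1 + r ^ 2) ^ s := Real.rpow_le_rpow (by positivity) (by linarith) hs
      _ ≤ _ := le_mul_of_one_le_left (by positivity) h17
  · have h1 : (1 + r ^ 2) / 17 ≤ r ^ 2 := by nlinarith
    calc (r ^ 2) ^ s ≤ ((1 + r ^ 2) / 17) ^ s :=
          Real.rpow_le_rpow_of_nonpos (by positivity) h1 hs
      _ = _ := by
        rw [Real.div_rpow (by positivity) (by norm_num), abs_of_nonpos hs,
          Real.rpow_neg (by norm_num)]
        ring

theorem exists_symbol_le_of_quarter_le_norm (n : ℕ) (s a : ℝ) :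
    ∃ C > (0 : ℝ), ∀ t : ℝ, 0 ≤ t → ∀ ξ : Rn n, 1 / 4 ≤ ‖ξ‖ →
      ‖ξ‖ ^ (2 * s) * Khat t ξ ^ 2 ≤ C * (1 + t) ^ a * (1 + ‖ξ‖ ^ 2) ^ (s - 1) := by
  obtain ⟨C, hC, hb⟩ := exists_one_add_sq_mul_exp_le_rpow a
  refine ⟨17 ^ |s| * (4 * C), by positivity, fun t ht ξ hξ => ?_⟩
  have hp : 0 < 1 + ‖ξ‖ ^ 2 := by positivity
  calc ‖ξ‖ ^ (2 * s) * Khat t ξ ^ 2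
      ≤ 17 ^ |s| * (1 + ‖ξ‖ ^ 2) ^ s * Khat t ξ ^ 2 := by
        gcongr; exact rpow_two_mul_le_of_quarter_le hξ s
    _ = 17 ^ |s| * (1 + ‖ξ‖ ^ 2) ^ (s - 1) * (Khat t ξ ^ 2 * (1 + ‖ξ‖ ^ 2)) := by
        rw [Real.rpow_sub_one hp.ne']; field_simp
    _ ≤ 17 ^ |s| * (1 + ‖ξ‖ ^ 2) ^ (s - 1) * (4 * (C * (1 + t) ^ a)) := by
        refine mul_le_mul_of_nonneg_left ?_ (by positivity)
        linarith [Khat_sq_mul_le_of_quarter_le_norm ht hξ, hb t ht]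
    _ = _ := by ring

theorem symbol_le_of_norm_le_quarter {n : ℕ} (q s : ℝ) {t : ℝ} (ht : 0 ≤ t) {ξ : Rn n}
    (h0 : ξ ≠ 0) (h : ‖ξ‖ ≤ 1 / 4) :
    ‖ξ‖ ^ (2 * s) * Khat t ξ ^ 2 ≤ 16 * Real.exp (1 / 8) *
      (‖ξ‖ ^ (2 * (s - q)) * Real.exp (-(2 * (1 + t)) * ‖ξ‖ ^ 2)) * (‖ξ‖ ^ q) ^ 2 := by
  have hr : 0 < ‖ξ‖ := norm_pos_iff.mpr h0
  have hsq : ‖ξ‖ ^ 2 ≤ 1 / 16 := by nlinarith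
  have hK : Khat t ξ ^ 2 ≤ 16 * (Real.exp (1 / 8) * Real.exp (-(2 * (1 + t)) * ‖ξ‖ ^ 2)) := by
    calc Khat t ξ ^ 2 = |Khat t ξ| ^ 2 := (sq_abs _).symm
      _ ≤ (4 * Real.exp (-t * ‖ξ‖ ^ 2)) ^ 2 :=
        pow_le_pow_left₀ (abs_nonneg _) (abs_Khat_le_of_norm_le_quarter ht h) 2
      _ = 16 * Real.exp (2 * (-t * ‖ξ‖ ^ 2)) := by
        rw [mul_pow, ← Real.exp_nat_mul]; norm_num
      _ ≤ _ := by
        rw [← Real.exp_add]; gcongr; linarith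
  have hpow : ‖ξ‖ ^ (2 * s) = ‖ξ‖ ^ (2 * (s - q)) * (‖ξ‖ ^ q) ^ 2 := by
    rw [← Real.rpow_mul_natCast hr.le, ← Real.rpow_add hr]; congr 1; push_cast; ring
  rw [hpow]
  calc _ ≤ ‖ξ‖ ^ (2 * (s - q)) * (‖ξ‖ ^ q) ^ 2 *
        (16 * (Real.exp (1 / 8) * Real.exp (-(2 * (1 + t)) * ‖ξ‖ ^ 2))) := by gcongr
    _ = _ := by ring

theorem exists_lintegral_rpow_mul_gaussian_le {n : ℕ} (hn : 1 ≤ n) {p : ℝ} (hp : -(n : ℝ) < p) :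
    ∃ C > (0 : ℝ), ∀ b : ℝ, 0 < b →
      ∫⁻ ξ : Rn n, ENNReal.ofReal (‖ξ‖ ^ p * Real.exp (-b * ‖ξ‖ ^ 2))
        ≤ ENNReal.ofReal (C * b ^ (-(p + n) / 2)) := by
  have : Nonempty (Fin n) := ⟨⟨0, hn⟩⟩
  have hcast : ((n - 1 : ℕ) : ℝ) = (n : ℝ) - 1 := by push_cast [hn]; rfl
  have hexp : -1 < (n : ℝ) - 1 + p := by linarith
  set V := (volume : Measure (Rn n)).real (Metric.ball 0 1) with hV
  have hrad : ∀ b : ℝ, Set.EqOn (fun y : ℝ => y ^ (n - 1) • (y ^ p * Real.exp (-b * y ^ 2)))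
      (fun y => y ^ ((n : ℝ) - 1 + p) * Real.exp (-b * y ^ (2 : ℝ))) (Set.Ioi 0) := by
    intro b y hy
    simp only [smul_eq_mul]
    rw [Real.rpow_add hy, ← hcast, Real.rpow_natCast, Real.rpow_two]
    ring
  refine ⟨n * V * (1 / 2 * Real.Gamma (((n : ℝ) - 1 + p + 1) / 2)) + 1, ?_, fun b hb => ?_⟩
  · have := Real.Gamma_pos_of_pos (show 0 < ((n : ℝ) - 1 + p + 1) / 2 by linarith)
    positivity
  have hint : Integrable (fun ξ : Rn n => ‖ξ‖ ^ p * Real.exp (-b * ‖ξ‖ ^ 2)) := by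
    rw [integrable_fun_norm_addHaar volume (f := fun y : ℝ => y ^ p * Real.exp (-b * y ^ 2))]
    simp only [finrank_euclideanSpace, Fintype.card_fin]
    exact (integrableOn_rpow_mul_exp_neg_mul_rpow hexp two_pos hb).congr_fun
      (hrad b).symm measurableSet_Ioi
  rw [← ofReal_integral_eq_lintegral_ofReal hint (Eventually.of_forall fun ξ => by positivity)]
  apply ENNReal.ofReal_le_ofReal
  rw [integral_fun_norm_addHaar volume (fun y : ℝ => y ^ p * Real.exp (-b * y ^ 2))]
  simp only [finrank_euclideanSpace, Fintype.card_fin]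
  rw [setIntegral_congr_fun measurableSet_Ioi (hrad b),
    integral_rpow_mul_exp_neg_mul_rpow two_pos hexp hb]
  have he : -((n : ℝ) - 1 + p + 1) / 2 = -(p + n) / 2 := by ring
  rw [he, nsmul_eq_mul, smul_eq_mul]
  nlinarith [Real.rpow_pos_of_pos hb (-(p + n) / 2)]

theorem stmt_5 (n : ℕ) (hn : 1 ≤ n) (q s : ℝ) (hq0 : 0 ≤ q) (hq : q < (n:ℝ)/2)
    (hs : q - (n:ℝ)/2 < s) :
    ∃ C > (0:ℝ), ∀ t : ℝ, 0 ≤ t → ∀ f : Rn n → ℂ, Measurable f →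
      (∫⁻ ξ : Rn n, ENNReal.ofReal (‖ξ‖ ^ (2*s) * (Khat t ξ)^2 * ‖f ξ‖^2)) ^ ((1:ℝ)/2)
        ≤ ENNReal.ofReal (C * (1+t) ^ (-(n:ℝ)/4 - (s-q)/2)) *
          ((∫⁻ ξ : Rn n, ENNReal.ofReal ((1+‖ξ‖^2) ^ (s-1) * ‖f ξ‖^2)) ^ ((1:ℝ)/2)
            + ⨆ ξ : Rn n, ENNReal.ofReal (‖ξ‖ ^ q * ‖f ξ‖)) := by
  have : Nonempty (Fin n) := ⟨⟨0, hn⟩⟩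
  set a : ℝ := -(n : ℝ) / 2 - (s - q) with ha
  obtain ⟨A, hA, hhigh⟩ := exists_symbol_le_of_quarter_le_norm n s a
  obtain ⟨B, hB, hgauss⟩ :=
    exists_lintegral_rpow_mul_gaussian_le hn (p := 2 * (s - q)) (by linarith)
  set L : ℝ := 16 * Real.exp (1 / 8) with hL
  have hLpos : 0 < L := by positivity
  set K : ℝ := A + L * (B * 2 ^ a) with hK
  have hKpos : 0 < K := by positivity
  refine ⟨K ^ ((1 : ℝ) / 2), by positivity, fun t ht f hf => ?_⟩
  have ht1 : 0 < 1 + t := by linarith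
  set D : ℝ := (1 + t) ^ a with hD
  have hDpos : 0 < D := by positivity
  set M : ℝ≥0∞ := ⨆ ξ : Rn n, ENNReal.ofReal (‖ξ‖ ^ q * ‖f ξ‖) with hM
  set G : ℝ≥0∞ := ∫⁻ ξ : Rn n, ENNReal.ofReal ((1 + ‖ξ‖ ^ 2) ^ (s - 1) * ‖f ξ‖ ^ 2) with hG
  let w : Rn n → ℝ := fun ξ => ‖ξ‖ ^ (2 * (s - q)) * Real.exp (-(2 * (1 + t)) * ‖ξ‖ ^ 2)
  have hw0 : ∀ ξ, 0 ≤ w ξ := fun ξ => by positivity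
  have hwm : Measurable w := by fun_prop
  have hpt : ∀ᵐ ξ : Rn n, ENNReal.ofReal (‖ξ‖ ^ (2 * s) * Khat t ξ ^ 2 * ‖f ξ‖ ^ 2) ≤
      ENNReal.ofReal (A * D) * ENNReal.ofReal ((1 + ‖ξ‖ ^ 2) ^ (s - 1) * ‖f ξ‖ ^ 2) +
        ENNReal.ofReal L * M ^ 2 * ENNReal.ofReal (w ξ) := by
    filter_upwards [Measure.ae_ne volume (0 : Rn n)] with ξ hξ
    rcases le_total ‖ξ‖ (1 / 4) with h | h
    · refine le_add_left ?_
      have hfM : ENNReal.ofReal (‖ξ‖ ^ q * ‖f ξ‖) ≤ M :=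
        le_iSup (fun ξ : Rn n => ENNReal.ofReal (‖ξ‖ ^ q * ‖f ξ‖)) ξ
      calc ENNReal.ofReal (‖ξ‖ ^ (2 * s) * Khat t ξ ^ 2 * ‖f ξ‖ ^ 2)
          ≤ ENNReal.ofReal (L * (‖ξ‖ ^ q * ‖f ξ‖) ^ 2 * w ξ) := by
            apply ENNReal.ofReal_le_ofReal
            calc _ ≤ L * w ξ * (‖ξ‖ ^ q) ^ 2 * ‖f ξ‖ ^ 2 := by
                  gcongr ?_ * _
                  exact symbol_le_of_norm_le_quarter q s ht hξ h
              _ = _ := by ring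
        _ = ENNReal.ofReal L * ENNReal.ofReal (‖ξ‖ ^ q * ‖f ξ‖) ^ 2 * ENNReal.ofReal (w ξ) := by
            rw [ENNReal.ofReal_mul (by positivity), ENNReal.ofReal_mul hLpos.le,
              ENNReal.ofReal_pow (by positivity)]
        _ ≤ _ := by gcongr
    · refine le_add_right ?_
      rw [← ENNReal.ofReal_mul (by positivity), ← mul_assoc]
      apply ENNReal.ofReal_le_ofReal
      gcongr ?_ * _
      exact hhigh t ht ξ h
  have hexp : -(2 * (s - q) + (n : ℝ)) / 2 = a := by rw [ha]; ring
  have hwint : ∫⁻ ξ, ENNReal.ofReal (w ξ) ≤ ENNReal.ofReal (B * 2 ^ a * D) := by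
    have h := hgauss (2 * (1 + t)) (by positivity)
    rwa [hexp, Real.mul_rpow two_pos.le ht1.le, ← mul_assoc] at h
  have hmain : ∫⁻ ξ : Rn n, ENNReal.ofReal (‖ξ‖ ^ (2 * s) * Khat t ξ ^ 2 * ‖f ξ‖ ^ 2) ≤
      ENNReal.ofReal (K * D) * (G + M ^ 2) := by
    calc _ ≤ ENNReal.ofReal (A * D) * G +
          ENNReal.ofReal L * M ^ 2 * ∫⁻ ξ, ENNReal.ofReal (w ξ) := by
          refine (lintegral_mono_ae hpt).trans_eq ?_
          rw [lintegral_add_right _ (by fun_prop), lintegral_const_mul' _ _ ENNReal.ofReal_ne_top,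
            lintegral_const_mul _ (by fun_prop)]
      _ ≤ ENNReal.ofReal (A * D) * G +
          ENNReal.ofReal L * M ^ 2 * ENNReal.ofReal (B * 2 ^ a * D) := by gcongr
      _ = ENNReal.ofReal (A * D) * G + ENNReal.ofReal (L * (B * 2 ^ a * D)) * M ^ 2 := by
          rw [ENNReal.ofReal_mul hLpos.le]; ring
      _ ≤ ENNReal.ofReal (K * D) * G + ENNReal.ofReal (K * D) * M ^ 2 := by
          have h1 : A ≤ K := le_add_of_nonneg_right (by positivity)
          have h2 : L * (B * 2 ^ a * D) ≤ K * D := by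
            rw [hK, add_mul]
            nlinarith [mul_pos hA hDpos]
          gcongr
      _ = _ := (mul_add _ _ _).symm
  have hMsq : (M ^ 2) ^ ((1 : ℝ) / 2) = M := by
    rw [← ENNReal.rpow_natCast, ← ENNReal.rpow_mul]; norm_num
  have hDhalf : D ^ ((1 : ℝ) / 2) = (1 + t) ^ (-(n : ℝ) / 4 - (s - q) / 2) := by
    rw [hD, ← Real.rpow_mul ht1.le, ha]; congr 1; ring
  calc _ ≤ (ENNReal.ofReal (K * D) * (G + M ^ 2)) ^ ((1 : ℝ) / 2) :=
        ENNReal.rpow_le_rpow hmain (by norm_num)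
    _ = ENNReal.ofReal (K ^ ((1 : ℝ) / 2) * D ^ ((1 : ℝ) / 2)) *
          (G + M ^ 2) ^ ((1 : ℝ) / 2) := by
        rw [ENNReal.mul_rpow_of_nonneg _ _ (by norm_num),
          ENNReal.ofReal_rpow_of_nonneg (by positivity) (by norm_num),
          Real.mul_rpow hKpos.le hDpos.le]
    _ ≤ ENNReal.ofReal (K ^ ((1 : ℝ) / 2) * D ^ ((1 : ℝ) / 2)) *
          (G ^ ((1 : ℝ) / 2) + (M ^ 2) ^ ((1 : ℝ) / 2)) := by
        gcongr
        exact ENNReal.rpow_add_le_add_rpow _ _ (by norm_num) (by norm_num)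
    _ = _ := by rw [hMsq, hDhalf]

end
end

section
/- There exist constants ε ∈ (0, 1/2), c > 0, and C > 0 such that for every n ≥ 1, every t ≥ 0, and every ξ ∈ ℝⁿ with |ξ| ≤ ε, one has |K̂(t,ξ)| ≤ C ( e^{−ct} + e^{−c|ξ|² t} ). -/
open MeasureTheory Real FourierTransform Filter
open scoped ENNReal

noncomputable section

theorem stmt_8 :
    ∃ ε ∈ Set.Ioo (0:ℝ) (1/2), ∃ c > (0:ℝ), ∃ C > (0:ℝ),
      ∀ (n : ℕ), 1 ≤ n → ∀ t : ℝ, 0 ≤ t → ∀ ξ : Rn n, ‖ξ‖ ≤ ε →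
        |Khat t ξ| ≤ C * (Real.exp (-(c*t)) + Real.exp (-(c * ‖ξ‖^2 * t))) := by
  refine ⟨1/4, ⟨by norm_num, by norm_num⟩, 1, one_pos, 2, two_pos, ?_⟩
  intro n _ t ht ξ hξ
  have hr : 0 ≤ ‖ξ‖ := norm_nonneg ξ
  have hsq : ‖ξ‖ ^ 2 ≤ 1/16 := by nlinarith
  set s := Real.sqrt (1/4 - ‖ξ‖ ^ 2) with hs
  have hlow : 1/4 ≤ s := Real.le_sqrt_of_sq_le (by linarith)
  have hup : s ≤ 1/2 - ‖ξ‖ ^ 2 :=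
    Real.sqrt_le_iff.mpr ⟨by linarith, by nlinarith [sq_nonneg (‖ξ‖ ^ 2)]⟩
  have hspos : 0 < s := by linarith
  have hsinh_nonneg : 0 ≤ Real.sinh (t * s) := Real.sinh_nonneg_iff.mpr (by positivity)
  have hsinh : Real.sinh (t * s) ≤ Real.exp (t * s) / 2 := by
    rw [Real.sinh_eq]
    linarith [Real.exp_pos (-(t * s))]
  have hexp : Real.exp (-t/2) * Real.exp (t * s) ≤ Real.exp (-(1 * ‖ξ‖ ^ 2 * t)) := by
    rw [← Real.exp_add]
    exact Real.exp_le_exp.mpr (by nlinarith [mul_le_mul_of_nonneg_left hup ht])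
  rw [Khat, if_pos (by linarith), ← hs, abs_of_nonneg (by positivity), div_le_iff₀ hspos]
  have hnum : Real.exp (-t/2) * Real.sinh (t * s) ≤ Real.exp (-(1 * ‖ξ‖ ^ 2 * t)) / 2 := by
    linarith [mul_le_mul_of_nonneg_left hsinh (Real.exp_pos (-t/2)).le]
  have h₁ := Real.exp_pos (-(1 * t))
  have h₂ := Real.exp_pos (-(1 * ‖ξ‖ ^ 2 * t))
  nlinarith [mul_le_mul_of_nonneg_left hlow (add_pos h₁ h₂).le]

end
end

section
/- There exist constants ε ∈ (0, 1/2), c > 0, and C > 0 such that for every n ≥ 1, every t ≥ 0, and every ξ ∈ ℝⁿ with |ξ| ≤ ε, one has |∂_t K̂(t,ξ)| ≤ C ( e^{−ct} + |ξ|² e^{−c|ξ|² t} ), where ∂_t K̂(t,ξ) is the derivative of t ↦ K̂(t,ξ). -/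
open MeasureTheory Real FourierTransform Filter
open scoped ENNReal

noncomputable section

theorem hasDerivAt_exp_mul_sinh_div {s : ℝ} (hs : s ≠ 0) (t : ℝ) :
    HasDerivAt (fun u => Real.exp (-u/2) * Real.sinh (u * s) / s)
      ((s + 1/2) / (2 * s) * Real.exp (-((s + 1/2) * t))
        - (1/2 - s) / (2 * s) * Real.exp (-((1/2 - s) * t))) t := by
  have he : HasDerivAt (fun u : ℝ => Real.exp (-u/2)) (Real.exp (-t/2) * (-1/2)) t :=
    ((hasDerivAt_id t).neg.div_const 2).exp
  have hsinh : HasDerivAt (fun u : ℝ => Real.sinh (u * s)) (Real.cosh (t * s) * (1 * s)) t :=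
    ((hasDerivAt_id t).mul_const s).sinh
  refine ((he.mul hsinh).div_const s).congr_deriv ?_
  rw [show -((s + 1/2) * t) = -t/2 + -(t * s) by ring,
    show -((1/2 - s) * t) = -t/2 + t * s by ring, Real.exp_add, Real.exp_add,
    Real.cosh_eq, Real.sinh_eq]
  field_simp
  ring

theorem KhatDt_of_norm_lt_half {n : ℕ} (t : ℝ) {ξ : Rn n} (hξ : ‖ξ‖ < 1/2) {s : ℝ}
    (hs : s = Real.sqrt (1/4 - ‖ξ‖^2)) :
    KhatDt t ξ = (s + 1/2) / (2 * s) * Real.exp (-((s + 1/2) * t))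
      - (1/2 - s) / (2 * s) * Real.exp (-((1/2 - s) * t)) := by
  have hs0 : 0 < s := by
    rw [hs]
    exact Real.sqrt_pos.2 (by nlinarith [norm_nonneg ξ])
  simp only [KhatDt, Khat, if_pos hξ, ← hs]
  exact (hasDerivAt_exp_mul_sinh_div hs0.ne' t).deriv

theorem stmt_9 :
    ∃ ε ∈ Set.Ioo (0:ℝ) (1/2), ∃ c > (0:ℝ), ∃ C > (0:ℝ),
      ∀ (n : ℕ), 1 ≤ n → ∀ t : ℝ, 0 ≤ t → ∀ ξ : Rn n, ‖ξ‖ ≤ ε →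
        |KhatDt t ξ| ≤ C * (Real.exp (-(c*t)) + ‖ξ‖^2 * Real.exp (-(c * ‖ξ‖^2 * t))) := by
  refine ⟨1/4, by norm_num, 1/2, by norm_num, 4, by norm_num, fun n _ t ht ξ hξ => ?_⟩
  obtain ⟨s, hs⟩ : ∃ s, s = Real.sqrt (1/4 - ‖ξ‖^2) := ⟨_, rfl⟩
  have hξ0 := norm_nonneg ξ
  have hsq : s^2 = 1/4 - ‖ξ‖^2 := by
    rw [hs]
    exact Real.sq_sqrt (by nlinarith)
  have hs_nonneg : 0 ≤ s := hs ▸ Real.sqrt_nonneg _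
  have hs_ge : 1/4 ≤ s := by nlinarith
  have hs_le : s ≤ 1/2 := by nlinarith
  have hfast : (s + 1/2) / (2 * s) ≤ 4 := by
    rw [div_le_iff₀ (by positivity)]
    linarith
  have hslow : (1/2 - s) / (2 * s) ≤ 4 * ‖ξ‖^2 := by
    rw [div_le_iff₀ (by positivity)]
    nlinarith [mul_nonneg (sub_nonneg.2 hs_ge) (sq_nonneg ‖ξ‖)]
  have hexp_fast : Real.exp (-((s + 1/2) * t)) ≤ Real.exp (-(1/2 * t)) :=
    Real.exp_le_exp.2 (by nlinarith)
  have hrate : 1/2 * ‖ξ‖^2 ≤ 1/2 - s := by nlinarith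
  have hexp_slow : Real.exp (-((1/2 - s) * t)) ≤ Real.exp (-(1/2 * ‖ξ‖^2 * t)) :=
    Real.exp_le_exp.2 (neg_le_neg (mul_le_mul_of_nonneg_right hrate ht))
  have hd : 0 ≤ 1/2 - s := sub_nonneg.2 hs_le
  rw [KhatDt_of_norm_lt_half t (by linarith) hs]
  calc _ ≤ |(s + 1/2) / (2 * s) * Real.exp (-((s + 1/2) * t))|
        + |(1/2 - s) / (2 * s) * Real.exp (-((1/2 - s) * t))| := abs_sub _ _
    _ = (s + 1/2) / (2 * s) * Real.exp (-((s + 1/2) * t))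
        + (1/2 - s) / (2 * s) * Real.exp (-((1/2 - s) * t)) := by
      rw [abs_of_nonneg (by positivity), abs_of_nonneg (by positivity)]
    _ ≤ 4 * Real.exp (-(1/2 * t)) + 4 * ‖ξ‖^2 * Real.exp (-(1/2 * ‖ξ‖^2 * t)) := by
      gcongr
    _ = _ := by ring

end
end

section
/- For every ε ∈ (0, 1/2) there exist constants c > 0 and C > 0 such that for every n ≥ 1, every t ≥ 0, and every ξ ∈ ℝⁿ with |ξ| ≥ ε, one has |∂_t K̂(t,ξ)| ≤ C e^{−ct}, where ∂_t K̂(t,ξ) is the derivative of t ↦ K̂(t,ξ). -/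
open MeasureTheory Real FourierTransform Filter
open scoped ENNReal

noncomputable section

theorem abs_sinh_mul_div_le {a t : ℝ} (ha : 0 < a) (ht : 0 ≤ t) :
    |Real.sinh (t * a) / a| ≤ t * Real.exp (t * a) := by
  have hta : 0 ≤ t * a := by positivity
  have h0 : 0 ≤ Real.sinh (t * a) := Real.sinh_nonneg_iff.2 hta
  rw [abs_of_nonneg (by positivity), div_le_iff₀ ha, Real.sinh_eq]
  have h1 : Real.exp (-(t * a)) = Real.exp (t * a) * Real.exp (-2 * (t * a)) := by
    rw [← Real.exp_add]; congr 1; ring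
  have h2 := mul_le_mul_of_nonneg_left (Real.add_one_le_exp (-2 * (t * a)))
    (Real.exp_pos (t * a)).le
  rw [h1]
  linarith

theorem abs_sin_mul_div_le {a t : ℝ} (ha : 0 < a) (ht : 0 ≤ t) :
    |Real.sin (t * a) / a| ≤ t := by
  rw [abs_div, abs_of_pos ha, div_le_iff₀ ha]
  exact Real.abs_sin_le_abs.trans_eq (abs_of_nonneg (by positivity))

theorem cosh_le_exp_of_nonneg {x : ℝ} (hx : 0 ≤ x) : Real.cosh x ≤ Real.exp x := by
  have h : Real.exp (-x) ≤ Real.exp x := Real.exp_le_exp.2 (by linarith)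
  rw [Real.cosh_eq]
  linarith

theorem hasDerivAt_exp_neg_half (t : ℝ) :
    HasDerivAt (fun s : ℝ => Real.exp (-s / 2)) (Real.exp (-t / 2) * (-1 / 2)) t :=
  (((hasDerivAt_id t).neg).div_const 2).exp

theorem KhatDt_of_norm_lt {n : ℕ} (t : ℝ) {ξ : Rn n} (h : ‖ξ‖ < 1 / 2) :
    KhatDt t ξ = Real.exp (-t / 2) * (Real.cosh (t * √(1 / 4 - ‖ξ‖ ^ 2)) -
      Real.sinh (t * √(1 / 4 - ‖ξ‖ ^ 2)) / √(1 / 4 - ‖ξ‖ ^ 2) / 2) := by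
  have ha : 0 < √(1 / 4 - ‖ξ‖ ^ 2) := Real.sqrt_pos.2 (by nlinarith [norm_nonneg ξ])
  simp only [KhatDt, Khat, if_pos h]
  set a := √(1 / 4 - ‖ξ‖ ^ 2)
  refine (((hasDerivAt_exp_neg_half t).mul
    ((hasDerivAt_id t).mul_const a).sinh).div_const a).deriv.trans ?_
  simp only [id]
  field_simp
  ring

theorem KhatDt_of_norm_eq {n : ℕ} (t : ℝ) {ξ : Rn n} (h : ‖ξ‖ = 1 / 2) :
    KhatDt t ξ = Real.exp (-t / 2) * (1 - t / 2) := by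
  simp only [KhatDt, Khat, if_neg h.not_lt, if_pos h]
  refine ((hasDerivAt_id t).mul (hasDerivAt_exp_neg_half t)).deriv.trans ?_
  simp only [id]
  ring

theorem KhatDt_of_lt_norm {n : ℕ} (t : ℝ) {ξ : Rn n} (h : 1 / 2 < ‖ξ‖) :
    KhatDt t ξ = Real.exp (-t / 2) * (Real.cos (t * √(‖ξ‖ ^ 2 - 1 / 4)) -
      Real.sin (t * √(‖ξ‖ ^ 2 - 1 / 4)) / √(‖ξ‖ ^ 2 - 1 / 4) / 2) := by
  have ha : 0 < √(‖ξ‖ ^ 2 - 1 / 4) := Real.sqrt_pos.2 (by nlinarith)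
  simp only [KhatDt, Khat, if_neg h.not_gt, if_neg h.ne']
  set a := √(‖ξ‖ ^ 2 - 1 / 4)
  refine (((hasDerivAt_exp_neg_half t).mul
    ((hasDerivAt_id t).mul_const a).sin).div_const a).deriv.trans ?_
  simp only [id]
  field_simp
  ring

theorem abs_KhatDt_le_of_half_le {n : ℕ} {t : ℝ} (ht : 0 ≤ t) {ξ : Rn n} (h : 1 / 2 ≤ ‖ξ‖) :
    |KhatDt t ξ| ≤ Real.exp (-t / 2) * (1 + t / 2) := by
  rcases h.eq_or_lt with h | h
  · rw [KhatDt_of_norm_eq t h.symm, abs_mul, Real.abs_exp]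
    gcongr
    rw [abs_le]
    constructor <;> linarith
  · have ha : 0 < √(‖ξ‖ ^ 2 - 1 / 4) := Real.sqrt_pos.2 (by nlinarith)
    rw [KhatDt_of_lt_norm t h, abs_mul, Real.abs_exp]
    gcongr
    refine (abs_sub _ _).trans ?_
    rw [abs_div _ (2 : ℝ), abs_two]
    gcongr
    · exact Real.abs_cos_le_one _
    · exact abs_sin_mul_div_le ha ht

theorem abs_KhatDt_le_of_norm_lt {n : ℕ} {t : ℝ} (ht : 0 ≤ t) {ξ : Rn n} (h : ‖ξ‖ < 1 / 2) :
    |KhatDt t ξ| ≤ Real.exp (-t / 2) * (Real.exp (t * √(1 / 4 - ‖ξ‖ ^ 2)) * (1 + t / 2)) := by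
  have ha : 0 < √(1 / 4 - ‖ξ‖ ^ 2) := Real.sqrt_pos.2 (by nlinarith [norm_nonneg ξ])
  rw [KhatDt_of_norm_lt t h, abs_mul, Real.abs_exp]
  gcongr
  refine (abs_sub _ _).trans ?_
  rw [abs_div _ (2 : ℝ), abs_two, abs_of_pos (Real.cosh_pos _)]
  linarith [abs_sinh_mul_div_le ha ht,
    cosh_le_exp_of_nonneg (x := t * √(1 / 4 - ‖ξ‖ ^ 2)) (by positivity)]

/-- Away from the origin in frequency, the derivative decays exponentially up to a linear factor,
with the rate `1 / 2 - √(1 / 4 - ε ^ 2)`. -/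
theorem abs_KhatDt_le {n : ℕ} {ε t : ℝ} (hε : 0 ≤ ε) (ht : 0 ≤ t) {ξ : Rn n} (hξ : ε ≤ ‖ξ‖) :
    |KhatDt t ξ| ≤ Real.exp (-((1 / 2 - √(1 / 4 - ε ^ 2)) * t)) * (1 + t / 2) := by
  rcases lt_or_ge ‖ξ‖ (1 / 2) with h | h
  · refine (abs_KhatDt_le_of_norm_lt ht h).trans ?_
    rw [← mul_assoc, ← Real.exp_add]
    have hs : √(1 / 4 - ‖ξ‖ ^ 2) ≤ √(1 / 4 - ε ^ 2) := by gcongr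
    gcongr
    linarith [mul_le_mul_of_nonneg_left hs ht]
  · refine (abs_KhatDt_le_of_half_le ht h).trans ?_
    gcongr
    linarith [mul_nonneg (Real.sqrt_nonneg (1 / 4 - ε ^ 2)) ht]

theorem exp_mul_one_add_half_le {c t : ℝ} (hc : 0 < c) (ht : 0 ≤ t) :
    Real.exp (-(2 * c * t)) * (1 + t / 2) ≤ (1 + 1 / (2 * c)) * Real.exp (-(c * t)) := by
  have h1 : Real.exp (-(2 * c * t)) = Real.exp (-(c * t)) * Real.exp (-(c * t)) := by
    rw [← Real.exp_add]; congr 1; ring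
  have h2 : Real.exp (-(c * t)) ≤ 1 := Real.exp_le_one_iff.2 (by nlinarith)
  have h3 : Real.exp (-(c * t)) * (c * t) ≤ 1 := by
    have h := mul_le_mul_of_nonneg_left (Real.add_one_le_exp (c * t)) (Real.exp_pos (-(c * t))).le
    rw [← Real.exp_add, neg_add_cancel, Real.exp_zero] at h
    linarith [Real.exp_pos (-(c * t))]
  have h4 : Real.exp (-(c * t)) * (1 + t / 2) ≤ 1 + 1 / (2 * c) := by
    have h5 : Real.exp (-(c * t)) * t / 2 ≤ 1 / (2 * c) := by
      rw [div_le_div_iff₀ two_pos (by positivity)]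
      linarith
    linarith
  rw [h1, mul_assoc, mul_comm (1 + 1 / (2 * c))]
  gcongr

theorem stmt_11 :
    ∀ ε ∈ Set.Ioo (0:ℝ) (1/2), ∃ c > (0:ℝ), ∃ C > (0:ℝ),
      ∀ (n : ℕ), 1 ≤ n → ∀ t : ℝ, 0 ≤ t → ∀ ξ : Rn n, ε ≤ ‖ξ‖ →
        |KhatDt t ξ| ≤ C * Real.exp (-(c*t)) := by
  rintro ε ⟨hε, hε'⟩
  have hb : √(1 / 4 - ε ^ 2) < 1 / 2 := by
    rw [Real.sqrt_lt' (by norm_num)]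
    nlinarith
  obtain ⟨c, hc⟩ : ∃ c, 2 * c = 1 / 2 - √(1 / 4 - ε ^ 2) :=
    ⟨(1 / 2 - √(1 / 4 - ε ^ 2)) / 2, by ring⟩
  have hc0 : 0 < c := by linarith
  refine ⟨c, hc0, 1 + 1 / (2 * c), by positivity, fun n _ t ht ξ hξ => ?_⟩
  refine (abs_KhatDt_le hε.le ht hξ).trans ?_
  rw [← hc]
  exact exp_mul_one_add_half_le hc0 ht

end
end

section
/- Let n ≥ 1, ε > 0, c > 0, and γ > −n/2. There exists a constant C > 0 such that for all t > 0: ( ∫_{|ξ| ≤ ε} |ξ|^{2γ} e^{−2c|ξ|² t} dξ )^{1/2} ≤ C (1+t)^{−n/4 − γ/2}. -/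
open MeasureTheory Real FourierTransform Filter
open scoped ENNReal

noncomputable section

/-- The radial integral of `‖ξ‖ ^ s * exp (-b ‖ξ‖ ^ 2)` over `ℝⁿ`, in polar coordinates. -/
theorem integrable_and_integral_norm_rpow_mul_exp_neg_mul_sq {n : ℕ} (hn : 1 ≤ n) {s b : ℝ}
    (hs : -(n : ℝ) < s) (hb : 0 < b) :
    Integrable (fun ξ : Rn n => ‖ξ‖ ^ s * Real.exp (-b * ‖ξ‖ ^ (2 : ℝ))) ∧
      ∫ ξ : Rn n, ‖ξ‖ ^ s * Real.exp (-b * ‖ξ‖ ^ (2 : ℝ)) =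
        n * (volume : Measure (Rn n)).real (Metric.ball 0 1) *
          (b ^ (-(s + n) / 2) * (1 / 2) * Real.Gamma ((s + n) / 2)) := by
  have : Nontrivial (Rn n) :=
    Module.nontrivial_of_finrank_pos (R := ℝ) (by rw [finrank_euclideanSpace_fin]; omega)
  have hq : -1 < s + n - 1 := by linarith
  have key : ∀ y ∈ Set.Ioi (0 : ℝ), y ^ (s + n - 1) * Real.exp (-b * y ^ (2 : ℝ)) =
      y ^ (n - 1) • (y ^ s * Real.exp (-b * y ^ (2 : ℝ))) := by
    intro y hy
    have hy : 0 < y := hy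
    rw [smul_eq_mul, ← mul_assoc, ← Real.rpow_natCast y (n - 1), ← Real.rpow_add hy,
      Nat.cast_sub hn, Nat.cast_one]
    congr 2
    ring
  constructor
  · have h := integrable_fun_norm_addHaar (volume : Measure (Rn n))
      (f := fun y : ℝ => y ^ s * Real.exp (-b * y ^ (2 : ℝ)))
    rw [h, finrank_euclideanSpace_fin]
    exact (integrableOn_rpow_mul_exp_neg_mul_rpow hq two_pos hb).congr_fun key measurableSet_Ioi
  · have h := integral_fun_norm_addHaar (volume : Measure (Rn n))
      (fun y : ℝ => y ^ s * Real.exp (-b * y ^ (2 : ℝ)))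
    rw [h, finrank_euclideanSpace_fin, ← setIntegral_congr_fun measurableSet_Ioi key,
      integral_rpow_mul_exp_neg_mul_rpow two_pos hq hb, nsmul_eq_mul, smul_eq_mul,
      sub_add_cancel]
    ring

theorem stmt_12 (n : ℕ) (hn : 1 ≤ n) (ε c γ : ℝ) (hε : 0 < ε) (hc : 0 < c)
    (hγ : -(n:ℝ)/2 < γ) :
    ∃ C > (0:ℝ), ∀ t : ℝ, 0 < t →
      (∫ ξ in {ξ : Rn n | ‖ξ‖ ≤ ε}, ‖ξ‖ ^ (2*γ) * Real.exp (-(2 * c * ‖ξ‖^2 * t))) ^ ((1:ℝ)/2)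
        ≤ C * (1+t) ^ (-(n:ℝ)/4 - γ/2) := by
  have hs : -(n : ℝ) < 2 * γ := by linarith
  have hG : 0 < Real.Gamma ((2 * γ + n) / 2) := Real.Gamma_pos_of_pos (by linarith)
  have hV : 0 < (volume : Measure (Rn n)).real (Metric.ball 0 1) :=
    ENNReal.toReal_pos (Metric.measure_ball_pos volume _ one_pos).ne' measure_ball_lt_top.ne
  have hn' : (0 : ℝ) < n := by exact_mod_cast hn
  set A : ℝ := Real.exp (2 * c * ε ^ 2) * (n * (volume : Measure (Rn n)).real (Metric.ball 0 1) *
    ((2 * c) ^ (-(2 * γ + n) / 2) * (1 / 2) * Real.Gamma ((2 * γ + n) / 2))) with hA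
  have hA0 : 0 < A := by positivity
  refine ⟨A ^ ((1 : ℝ) / 2), by positivity, fun t ht => ?_⟩
  have h1t : 0 < 1 + t := by linarith
  obtain ⟨hint, hval⟩ := integrable_and_integral_norm_rpow_mul_exp_neg_mul_sq hn hs
    (b := 2 * c * (1 + t)) (by positivity)
  have hnonneg : ∀ ξ : Rn n, 0 ≤ ‖ξ‖ ^ (2 * γ) * Real.exp (-(2 * c * ‖ξ‖ ^ 2 * t)) :=
    fun ξ => by positivity
  have hbound : (∫ ξ in {ξ : Rn n | ‖ξ‖ ≤ ε},
      ‖ξ‖ ^ (2 * γ) * Real.exp (-(2 * c * ‖ξ‖ ^ 2 * t))) ≤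
        A * (1 + t) ^ (-(2 * γ + n) / 2) := by
    calc _ ≤ ∫ ξ in {ξ : Rn n | ‖ξ‖ ≤ ε}, Real.exp (2 * c * ε ^ 2) *
            (‖ξ‖ ^ (2 * γ) * Real.exp (-(2 * c * (1 + t)) * ‖ξ‖ ^ (2 : ℝ))) := by
          refine integral_mono_of_nonneg (ae_of_all _ hnonneg)
            (hint.const_mul _).integrableOn ?_
          refine ae_restrict_of_forall_mem
            (measurableSet_le measurable_norm measurable_const) fun ξ hξ => ?_
          have hξ : ‖ξ‖ ≤ ε := hξ
          have hsq : ‖ξ‖ ^ 2 ≤ ε ^ 2 := by gcongr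
          simp only
          rw [mul_left_comm, ← Real.exp_add, Real.rpow_two]
          gcongr
          nlinarith
      _ ≤ ∫ ξ : Rn n, Real.exp (2 * c * ε ^ 2) *
            (‖ξ‖ ^ (2 * γ) * Real.exp (-(2 * c * (1 + t)) * ‖ξ‖ ^ (2 : ℝ))) :=
          setIntegral_le_integral (hint.const_mul _) (ae_of_all _ fun ξ => by positivity)
      _ = A * (1 + t) ^ (-(2 * γ + n) / 2) := by
          rw [integral_const_mul, hval, Real.mul_rpow (by positivity) h1t.le, hA]
          ring
  calc _ ≤ (A * (1 + t) ^ (-(2 * γ + n) / 2)) ^ ((1 : ℝ) / 2) :=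
        Real.rpow_le_rpow (integral_nonneg hnonneg) hbound (by norm_num)
    _ = _ := by
        rw [Real.mul_rpow hA0.le (by positivity), ← Real.rpow_mul h1t.le]
        congr 2
        ring

end
end

section
/- Let n ≥ 1, p > 1, and p' := p/(p−1). Let φ(x) := ⟨x⟩^{−n−1} on ℝⁿ and let χ : ℝ → [0,1] be a continuous function supported in [0,1]. Then there exists a constant C > 0 (depending only on n and p) such that for every R > 0: ∫₀^∞ ∫_{ℝⁿ} | Δ_x[ φ(x/R) ] |^{p'} · φ(x/R)^{−p'/p} · χ(t/R²) dx dt ≤ C R^{n+2−2p'}, where Δ_x denotes the Laplacian in the x variable. In particular, there is a constant C₀ > 0 with |Δφ(x)| ≤ C₀ ⟨x⟩^{−n−3} for all x ∈ ℝⁿ. -/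
open MeasureTheory Real FourierTransform Filter
open scoped ENNReal

noncomputable section

/-- The profile `y ↦ (1 + c‖y‖²) ^ a` has directional derivative
`2ac ⟪y, v⟫ (1 + c‖y‖²) ^ (a - 1)`. -/
lemma hasFDerivAt_one_add_mul_norm_sq_rpow {E : Type*} [NormedAddCommGroup E]
    [InnerProductSpace ℝ E] {c : ℝ} (hc : 0 ≤ c) (a : ℝ) (y : E) :
    HasFDerivAt (fun y : E => (1 + c * ‖y‖ ^ 2) ^ a)
      ((a * (1 + c * ‖y‖ ^ 2) ^ (a - 1)) • (c • (2 • innerSL ℝ y))) y := by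
  have hy : HasFDerivAt (fun y : E => 1 + c * ‖y‖ ^ 2) (c • (2 • innerSL ℝ y)) y :=
    ((hasStrictFDerivAt_norm_sq y).hasFDerivAt.const_mul c).const_add 1
  exact hy.rpow_const (Or.inl (by positivity))

lemma lap_one_add_mul_norm_sq_rpow {n : ℕ} {c : ℝ} (hc : 0 ≤ c) (a : ℝ) (x : Rn n) :
    lap (fun y : Rn n => (1 + c * ‖y‖ ^ 2) ^ a) x =
      2 * a * c * n * (1 + c * ‖x‖ ^ 2) ^ (a - 1) +
        4 * a * (a - 1) * c ^ 2 * ‖x‖ ^ 2 * (1 + c * ‖x‖ ^ 2) ^ (a - 2) := by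
  have hfirst (i : Fin n) : (fun y : Rn n =>
      fderiv ℝ (fun y : Rn n => (1 + c * ‖y‖ ^ 2) ^ a) y (EuclideanSpace.single i 1)) =
      fun y => 2 * a * c * ((1 + c * ‖y‖ ^ 2) ^ (a - 1) * y i) := by
    ext y
    rw [(hasFDerivAt_one_add_mul_norm_sq_rpow hc a y).fderiv]
    simp [EuclideanSpace.inner_single_right]
    ring
  have hsecond (i : Fin n) : fderiv ℝ (fun y : Rn n =>
      fderiv ℝ (fun y : Rn n => (1 + c * ‖y‖ ^ 2) ^ a) y (EuclideanSpace.single i 1)) x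
        (EuclideanSpace.single i 1) =
      2 * a * c * (1 + c * ‖x‖ ^ 2) ^ (a - 1) +
        4 * a * (a - 1) * c ^ 2 * (1 + c * ‖x‖ ^ 2) ^ (a - 2) * x i ^ 2 := by
    rw [hfirst i]
    have hcoord : HasFDerivAt (fun y : Rn n => y i) (EuclideanSpace.proj i : Rn n →L[ℝ] ℝ) x :=
      (EuclideanSpace.proj i : Rn n →L[ℝ] ℝ).hasFDerivAt
    have hprod : HasFDerivAt
        (fun y : Rn n => 2 * a * c * ((1 + c * ‖y‖ ^ 2) ^ (a - 1) * y i)) _ x :=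
      ((hasFDerivAt_one_add_mul_norm_sq_rpow hc (a - 1) x).mul hcoord).const_mul (2 * a * c)
    rw [hprod.fderiv]
    simp [EuclideanSpace.inner_single_right, show a - 1 - 1 = a - 2 by ring]
    ring
  unfold lap
  simp_rw [hsecond]
  rw [Finset.sum_add_distrib, ← Finset.mul_sum _ _ (4 * _ * _ * _ * _), ← EuclideanSpace.real_norm_sq_eq]
  simp
  ring

lemma abs_lap_one_add_mul_norm_sq_rpow_le {n : ℕ} {c : ℝ} (hc : 0 ≤ c) (a : ℝ) (x : Rn n) :
    |lap (fun y : Rn n => (1 + c * ‖y‖ ^ 2) ^ a) x| ≤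
      c * (2 * |a| * n + 4 * |a| * |a - 1|) * (1 + c * ‖x‖ ^ 2) ^ (a - 1) := by
  have hu : 0 < 1 + c * ‖x‖ ^ 2 := by positivity
  rw [lap_one_add_mul_norm_sq_rpow hc]
  have hsplit : (1 + c * ‖x‖ ^ 2) ^ (a - 1) =
      (1 + c * ‖x‖ ^ 2) ^ (a - 2) * (1 + c * ‖x‖ ^ 2) := by
    rw [← Real.rpow_add_one hu.ne']
    ring_nf
  refine (abs_add_le _ _).trans ?_
  simp only [abs_mul, abs_pow, abs_norm, Nat.abs_cast, Nat.abs_ofNat, abs_of_nonneg hc,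
    abs_of_pos (Real.rpow_pos_of_pos hu _)]
  have hle : c * ‖x‖ ^ 2 * (1 + c * ‖x‖ ^ 2) ^ (a - 2) ≤ (1 + c * ‖x‖ ^ 2) ^ (a - 1) := by
    rw [hsplit, mul_comm]
    gcongr
    linarith
  have := mul_le_mul_of_nonneg_left hle (show 0 ≤ 4 * |a| * |a - 1| * c by positivity)
  linarith

lemma lintegral_one_add_norm_sq_div_rpow {n : ℕ} {b R : ℝ} (hb : (n : ℝ) < b) (hR : 0 < R) :
    ∫⁻ x : Rn n, ENNReal.ofReal ((1 + ‖x‖ ^ 2 / R ^ 2) ^ (-b / 2)) =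
      ENNReal.ofReal (R ^ n * ∫ x : Rn n, (1 + ‖x‖ ^ 2) ^ (-b / 2)) := by
  have hint : Integrable (fun x : Rn n => (1 + ‖x‖ ^ 2) ^ (-b / 2)) :=
    integrable_rpow_neg_one_add_norm_sq (by simpa using hb)
  have hscale (x : Rn n) : 1 + ‖x‖ ^ 2 / R ^ 2 = 1 + ‖R⁻¹ • x‖ ^ 2 := by
    rw [norm_smul, Real.norm_of_nonneg (by positivity)]
    field_simp
  simp_rw [hscale]
  rw [← ofReal_integral_eq_lintegral_ofReal (hint.comp_smul (inv_ne_zero hR.ne'))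
    (Eventually.of_forall fun x => by positivity),
    Measure.integral_comp_inv_smul_of_nonneg volume
      (fun x : Rn n => (1 + ‖x‖ ^ 2) ^ (-b / 2)) hR.le]
  simp

theorem stmt_18 (n : ℕ) (hn : 1 ≤ n) (p p' : ℝ) (hp : 1 < p) (hp' : p' = p/(p-1)) :
    (∃ C₀ > (0:ℝ), ∀ x : Rn n,
        |lap (fun y : Rn n => (1 + ‖y‖^2) ^ (-((n:ℝ)+1)/2)) x|
          ≤ C₀ * (1 + ‖x‖^2) ^ (-((n:ℝ)+3)/2)) ∧
    ∃ C > (0:ℝ), ∀ χ : ℝ → ℝ, Continuous χ → (∀ t, χ t ∈ Set.Icc (0:ℝ) 1) →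
      Function.support χ ⊆ Set.Icc 0 1 →
      ∀ R : ℝ, 0 < R →
        (∫⁻ t in Set.Ioi (0:ℝ), ∫⁻ x : Rn n,
            ENNReal.ofReal
              (|lap (fun y : Rn n => (1 + ‖y‖^2/R^2) ^ (-((n:ℝ)+1)/2)) x| ^ p'
                * ((1 + ‖x‖^2/R^2) ^ (-((n:ℝ)+1)/2)) ^ (-(p'/p))
                * χ (t/R^2)))
          ≤ ENNReal.ofReal (C * R ^ ((n:ℝ) + 2 - 2*p')) := by
  set a : ℝ := -((n : ℝ) + 1) / 2 with ha
  have ha1 : -((n : ℝ) + 3) / 2 = a - 1 := by rw [ha]; ring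
  have ha_neg : a < 0 := by
    rw [ha]
    have : (0 : ℝ) ≤ n := n.cast_nonneg
    linarith
  set C₀ : ℝ := 2 * |a| * n + 4 * |a| * |a - 1| with hC₀
  have hC₀_pos : 0 < C₀ := by
    have h1 : 0 < |a| := abs_pos.2 ha_neg.ne
    have h2 : 0 < |a - 1| := abs_pos.2 (by linarith)
    positivity
  have hp'_pos : 0 < p' := by rw [hp']; exact div_pos (by linarith) (by linarith)
  have hconj : p' / p = p' - 1 := by
    have : p - 1 ≠ 0 := by linarith
    have : p ≠ 0 := by linarith
    rw [hp']
    field_simp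
    ring
  refine ⟨⟨C₀, hC₀_pos, fun x => ?_⟩, ?_⟩
  · rw [ha1]
    simpa using abs_lap_one_add_mul_norm_sq_rpow_le zero_le_one a x
  set I : ℝ := ∫ x : Rn n, (1 + ‖x‖ ^ 2) ^ (-((n : ℝ) + 1 + 2 * p') / 2) with hI
  have hI_nonneg : 0 ≤ I := integral_nonneg fun x => by positivity
  refine ⟨C₀ ^ p' * I + 1, by positivity, fun χ _ hχ hsupp R hR => ?_⟩
  have hR2 : 0 < R ^ 2 := by positivity
  set K : ℝ := (C₀ / R ^ 2) ^ p' with hK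
  have hK_nonneg : 0 ≤ K := by positivity
  have hpointwise (t : ℝ) (x : Rn n) :
      |lap (fun y : Rn n => (1 + ‖y‖ ^ 2 / R ^ 2) ^ a) x| ^ p'
        * ((1 + ‖x‖ ^ 2 / R ^ 2) ^ a) ^ (-(p' / p)) * χ (t / R ^ 2) ≤
      K * (1 + ‖x‖ ^ 2 / R ^ 2) ^ (-((n : ℝ) + 1 + 2 * p') / 2) := by
    have hu : 0 < 1 + ‖x‖ ^ 2 / R ^ 2 := by positivity
    have hlap := abs_lap_one_add_mul_norm_sq_rpow_le (inv_nonneg.2 hR2.le) a x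
    simp only [inv_mul_eq_div] at hlap
    rw [← hC₀] at hlap
    calc
      _ ≤ |lap (fun y : Rn n => (1 + ‖y‖ ^ 2 / R ^ 2) ^ a) x| ^ p'
          * ((1 + ‖x‖ ^ 2 / R ^ 2) ^ a) ^ (-(p' / p)) :=
        mul_le_of_le_one_right (by positivity) (hχ _).2
      _ ≤ (C₀ / R ^ 2 * (1 + ‖x‖ ^ 2 / R ^ 2) ^ (a - 1)) ^ p'
          * ((1 + ‖x‖ ^ 2 / R ^ 2) ^ a) ^ (-(p' / p)) := by gcongr
      _ = K * (1 + ‖x‖ ^ 2 / R ^ 2) ^ (-((n : ℝ) + 1 + 2 * p') / 2) := by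
        rw [Real.mul_rpow (by positivity) (by positivity), ← Real.rpow_mul hu.le,
          ← Real.rpow_mul hu.le, mul_assoc, ← Real.rpow_add hu, hconj]
        congr 2
        rw [ha]
        ring
  have hinner (t : ℝ) : ∫⁻ x : Rn n, ENNReal.ofReal
      (|lap (fun y : Rn n => (1 + ‖y‖ ^ 2 / R ^ 2) ^ a) x| ^ p'
        * ((1 + ‖x‖ ^ 2 / R ^ 2) ^ a) ^ (-(p' / p)) * χ (t / R ^ 2)) ≤
      (Set.Icc 0 (R ^ 2)).indicator (fun _ => ENNReal.ofReal (K * (R ^ n * I))) t := by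
    by_cases ht : t ∈ Set.Icc 0 (R ^ 2)
    · rw [Set.indicator_of_mem ht, ENNReal.ofReal_mul hK_nonneg, hI,
        ← lintegral_one_add_norm_sq_div_rpow (by linarith) hR,
        ← lintegral_const_mul' _ _ ENNReal.ofReal_ne_top]
      refine lintegral_mono fun x => ?_
      rw [← ENNReal.ofReal_mul hK_nonneg]
      exact ENNReal.ofReal_le_ofReal (hpointwise t x)
    · have hχ_zero : χ (t / R ^ 2) = 0 := by
        by_contra h
        obtain ⟨h0, h1⟩ := hsupp h
        exact ht ⟨by simpa using (le_div_iff₀ hR2).1 h0, by simpa using (div_le_iff₀ hR2).1 h1⟩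
      simp [hχ_zero]
  calc
    _ ≤ ∫⁻ t in Set.Ioi (0 : ℝ),
        (Set.Icc 0 (R ^ 2)).indicator (fun _ => ENNReal.ofReal (K * (R ^ n * I))) t :=
      lintegral_mono hinner
    _ ≤ ∫⁻ t, (Set.Icc 0 (R ^ 2)).indicator (fun _ => ENNReal.ofReal (K * (R ^ n * I))) t :=
      setLIntegral_le_lintegral _ _
    _ = ENNReal.ofReal (K * (R ^ n * I) * R ^ 2) := by
      rw [lintegral_indicator_const measurableSet_Icc, Real.volume_Icc, sub_zero,
        ← ENNReal.ofReal_mul (by positivity)]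
    _ = ENNReal.ofReal (C₀ ^ p' * I * R ^ ((n : ℝ) + 2 - 2 * p')) := by
      have hRpow : R ^ ((n : ℝ) + 2 - 2 * p') = R ^ n * R ^ 2 / (R ^ 2) ^ p' := by
        rw [Real.rpow_sub hR, Real.rpow_add hR, Real.rpow_mul hR.le, Real.rpow_natCast,
          Real.rpow_two]
      rw [hRpow, hK, Real.div_rpow hC₀_pos.le hR2.le]
      congr 1
      ring
    _ ≤ _ := by
      gcongr
      linarith

end
end
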